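/- For every integer base b ≥ 2, there exists u ∈ ℕ with F(u) = 3, and the least such u is K(3) = 129 if b = 2, K(3) = 28 if b = 3, K(3) = b^{b+3} + 1 if b ≥ 4 is even, and K(3) = b² + 1 if b ≥ 5 is odd; consequently B(3) = 7 if b = 2, B(3) = 3 if b = 3, B(3) = b + 3 if b ≥ 4 is even, and B(3) = 2 if b ≥ 5 is odd. -/

import Mathlib

namespace Kaprekar

/-- Sum of the digits of `v` in base `b`. -/
def s (b v : ℕ) : ℕ := (Nat.digits b v).sum

/-- `f v = v + s v`. -/
def f (b v : ℕ) : ℕ := v + s b v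

/-- `F u` is the number of generators of `u`. -/
noncomputable def F (b u : ℕ) : ℕ := Set.ncard {v : ℕ | f b v = u}

/-- `K n` is the least `u` with exactly `n` generators. -/
noncomputable def K (b n : ℕ) : ℕ := sInf {u : ℕ | F b u = n}

/-- `B n = ⌊log_b K(n)⌋`. -/
noncomputable def B (b n : ℕ) : ℕ := Nat.log b (K b n)

lemma s_eq_mod_add (b v : ℕ) (hb : 2 ≤ b) : s b v = v % b + s b (v / b) := by
  rcases Nat.eq_zero_or_pos v with rfl | hv
  · simp [s]
  · simp [s, Nat.digits_def' (by omega : 1 < b) hv]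

lemma s_zero (b : ℕ) : s b 0 = 0 := by simp [s]

lemma s_add_mul (b p x : ℕ) (hb : 2 ≤ b) (hx : x < b) : s b (b * p + x) = s b p + x := by
  rw [s_eq_mod_add b _ hb, Nat.mul_add_mod, Nat.mod_eq_of_lt hx, Nat.mul_add_div (by omega),
    Nat.div_eq_of_lt hx, add_zero, add_comm]

lemma s_of_lt (b x : ℕ) (hb : 2 ≤ b) (hx : x < b) : s b x = x := by
  simpa [s_zero] using s_add_mul b 0 x hb hx

lemma s_pos (b : ℕ) (hb : 2 ≤ b) : ∀ v, 0 < v → 0 < s b v := by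
  intro v
  induction v using Nat.strong_induction_on with
  | _ v ih =>
    intro hv
    rw [s_eq_mod_add b v hb]
    by_cases h : v % b = 0
    · have h1 := Nat.div_add_mod v b
      have h2 : 0 < v / b := by
        rcases Nat.eq_zero_or_pos (v / b) with h0 | h0
        · rw [h0, h] at h1
          omega
        · exact h0
      have := ih (v / b) (Nat.div_lt_self hv (by omega)) h2
      omega
    · omega

lemma s_le_of_lt_pow (b : ℕ) (hb : 2 ≤ b) : ∀ m v, v < b ^ m → s b v ≤ (b - 1) * m := by
  intro m
  induction m with
  | zero =>
    intro v hv
    have : v = 0 := by simpa using hv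
    simp [this, s_zero]
  | succ m ih =>
    intro v hv
    rw [s_eq_mod_add b v hb, mul_add, mul_one]
    have h1 := ih (v / b) (Nat.div_lt_of_lt_mul (by rwa [pow_succ, mul_comm] at hv))
    have h2 := Nat.mod_lt v (by omega : 0 < b)
    omega

/-- Adding one to `a` lowers the digit sum by `b - 1` for every trailing digit `b - 1`. -/
lemma exists_carry (b : ℕ) (hb : 2 ≤ b) :
    ∀ a, ∃ k, s b (a + 1) + (b - 1) * k = s b a + 1 ∧ b ^ k ∣ a + 1 := by
  intro a
  induction a using Nat.strong_induction_on with
  | _ a ih =>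
    have hd := Nat.div_add_mod a b
    have hm := Nat.mod_lt a (by omega : 0 < b)
    by_cases h : a % b + 1 < b
    · refine ⟨0, ?_, by simp⟩
      have h1 := s_add_mul b (a / b) (a % b + 1) hb h
      have h2 := s_add_mul b (a / b) (a % b) hb hm
      rw [← add_assoc, hd] at h1
      rw [hd] at h2
      omega
    · have ha : a / b < a := Nat.div_lt_self (by
        rcases Nat.eq_zero_or_pos a with rfl | h0
        · simp at h
          omega
        · exact h0) (by omega)
      obtain ⟨k, hk, hkd⟩ := ih (a / b) ha
      have e : a + 1 = b * (a / b + 1) := by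
        rw [mul_add, mul_one]
        omega
      refine ⟨k + 1, ?_, ?_⟩
      · have h1 := s_add_mul b (a / b + 1) 0 hb (by omega)
        have h2 := s_add_mul b (a / b) (a % b) hb hm
        rw [add_zero, ← e] at h1
        rw [hd] at h2
        rw [mul_add, mul_one]
        omega
      · rw [e, pow_succ, mul_comm]
        exact mul_dvd_mul_left b hkd

lemma s_pow (b n : ℕ) (hb : 2 ≤ b) : s b (b ^ n) = 1 := by
  induction n with
  | zero => simpa using s_of_lt b 1 hb (by omega)
  | succ n ih => simpa [pow_succ', ih] using s_add_mul b (b ^ n) 0 hb (by omega)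

lemma s_pow_sub_one (b n : ℕ) (hb : 2 ≤ b) : s b (b ^ n - 1) = n * (b - 1) := by
  induction n with
  | zero => simp [s_zero]
  | succ n ih =>
    have h0 : 0 < b ^ n := by positivity
    have e : b ^ (n + 1) - 1 = b * (b ^ n - 1) + (b - 1) := by
      obtain ⟨m, hm⟩ : ∃ m, b ^ n = m + 1 := ⟨b ^ n - 1, by omega⟩
      rw [pow_succ', hm, mul_add, Nat.add_sub_cancel]
      omega
    rw [e, s_add_mul b _ _ hb (by omega), ih]
    ring

lemma s_pow_sub_two (b n : ℕ) (hb : 2 ≤ b) (hn : 1 ≤ n) :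
    s b (b ^ n - 2) + 1 = n * (b - 1) := by
  obtain ⟨m, rfl⟩ : ∃ m, n = m + 1 := ⟨n - 1, by omega⟩
  have h0 : 0 < b ^ m := by positivity
  have e : b ^ (m + 1) - 2 = b * (b ^ m - 1) + (b - 2) := by
    obtain ⟨l, hl⟩ : ∃ l, b ^ m = l + 1 := ⟨b ^ m - 1, by omega⟩
    rw [pow_succ', hl, mul_add, Nat.add_sub_cancel]
    omega
  rw [e, s_add_mul b _ _ hb (by omega), s_pow_sub_one b m hb, add_mul]
  omega

lemma f_two_digits (b p x y : ℕ) (hb : 2 ≤ b) (hx : x < b) (hy : y < b) :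
    f b (b ^ 2 * p + b * x + y) = b ^ 2 * p + s b p + ((b + 1) * x + 2 * y) := by
  have e : b ^ 2 * p + b * x + y = b * (b * p + x) + y := by ring
  rw [f, e, s_add_mul b _ _ hb hy, s_add_mul b _ _ hb hx]
  ring

lemma exists_two_digits (b v : ℕ) (hb : 2 ≤ b) :
    ∃ x y, x < b ∧ y < b ∧ v = b ^ 2 * (v / b ^ 2) + b * x + y ∧
      f b v = b ^ 2 * (v / b ^ 2) + s b (v / b ^ 2) + ((b + 1) * x + 2 * y) := by
  have hx := Nat.mod_lt (v / b) (by omega : 0 < b)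
  have hy := Nat.mod_lt v (by omega : 0 < b)
  have e : v = b ^ 2 * (v / b ^ 2) + b * (v / b % b) + v % b := by
    have h1 := Nat.div_add_mod v b
    have h2 := Nat.div_add_mod (v / b) b
    have h3 : v / b ^ 2 = v / b / b := by rw [Nat.div_div_eq_div_mul, pow_two]
    calc v = b * (v / b) + v % b := h1.symm
      _ = b * (b * (v / b / b) + v / b % b) + v % b := by rw [h2]
      _ = _ := by rw [h3]; ring
  refine ⟨_, _, hx, hy, e, ?_⟩
  have := f_two_digits b (v / b ^ 2) _ _ hb hx hy
  rwa [← e] at this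

lemma digits_eq_of_even {b x y x' y' : ℕ} (he : Even b) (hy : y < b) (hy' : y' < b)
    (h : (b + 1) * x + 2 * y = (b + 1) * x' + 2 * y') : x = x' ∧ y = y' := by
  have key : ∀ x y x' y' : ℕ, y < b → x < x' →
      (b + 1) * x + 2 * y = (b + 1) * x' + 2 * y' → False := by
    intro x y x' y' hy hlt h
    obtain ⟨d, rfl⟩ := Nat.exists_eq_add_of_lt hlt
    obtain ⟨c, rfl⟩ := he
    rcases Nat.eq_zero_or_pos d with rfl | hd
    · ring_nf at h
      omega
    · nlinarith
  have hxx : x = x' := by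
    rcases lt_trichotomy x x' with hlt | heq | hgt
    · exact (key _ _ _ _ hy hlt h).elim
    · exact heq
    · exact (key _ _ _ _ hy' hgt h.symm).elim
  subst hxx
  exact ⟨rfl, by omega⟩

/-- For even `b`, the map `f` is injective on blocks of `b ^ 2` consecutive numbers. -/
lemma eq_of_f_eq_of_div_eq {b v v' : ℕ} (hb : 2 ≤ b) (he : Even b) (h : f b v = f b v')
    (hd : v / b ^ 2 = v' / b ^ 2) : v = v' := by
  obtain ⟨x, y, hx, hy, e, hf⟩ := exists_two_digits b v hb
  obtain ⟨x', y', hx', hy', e', hf'⟩ := exists_two_digits b v' hb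
  rw [hf, hf', hd] at h
  obtain ⟨rfl, rfl⟩ := digits_eq_of_even he hy hy' (Nat.add_left_cancel h)
  rw [e, e', hd]

/-- The arithmetic obstruction to three generators in consecutive blocks: `t₁` and `t₃` are the
values of `f` on the last two digits of the smallest and the largest generator, `k` is the number
of carries between their blocks. -/
lemma false_of_carry_eq {b k x₁ y₁ x₃ y₃ : ℕ} (hb : 2 ≤ b) (he : Even b) (hx : x₁ < b) (hy : y₁ < b)
    (hk : k ≤ b)
    (h : (b + 1) * x₁ + 2 * y₁ + (b - 1) * k = 2 * b ^ 2 + 2 + ((b + 1) * x₃ + 2 * y₃)) :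
    False := by
  obtain ⟨c, rfl⟩ : ∃ c, b = c + 1 := ⟨b - 1, by omega⟩
  rw [Nat.add_sub_cancel] at h
  have hkb : k = c + 1 := by
    by_contra hne
    have hk' : k ≤ c := by omega
    have h1 : c * k ≤ c * c := Nat.mul_le_mul_left _ hk'
    have h2 : (c + 1 + 1) * x₁ ≤ (c + 1 + 1) * c := Nat.mul_le_mul_left _ (by omega)
    nlinarith
  subst hkb
  have hx1 : x₁ = c := by
    by_contra hne
    have h2 : (c + 1 + 1) * (x₁ + 1) ≤ (c + 1 + 1) * c := Nat.mul_le_mul_left _ (by omega)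
    nlinarith
  subst hx1
  rcases Nat.eq_zero_or_pos x₃ with rfl | h3
  · have : 2 * y₁ = x₁ + 4 + 2 * y₃ := by nlinarith
    rcases he with ⟨d, hd⟩
    omega
  · have : (x₁ + 1 + 1) * 1 ≤ (x₁ + 1 + 1) * x₃ := Nat.mul_le_mul_left _ h3
    nlinarith

lemma false_of_three_even {b u v₁ v₂ v₃ : ℕ} (hb : 2 ≤ b) (he : Even b) (hu : u ≤ b ^ (b + 3))
    (h₁ : f b v₁ = u) (h₂ : f b v₂ = u) (h₃ : f b v₃ = u) (h12 : v₁ < v₂) (h23 : v₂ < v₃) :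
    False := by
  have hlt : ∀ v, 0 < v → f b v = u → v < b ^ (b + 3) := by
    intro v hv h
    have := s_pos b hb v hv
    rw [f] at h
    omega
  have hdiff : v₃ ≤ v₁ + 2 * b ^ 2 := by
    have h := s_le_of_lt_pow b hb (b + 3) v₁ (by have := hlt v₃ (by omega) h₃; omega)
    have h' : (b - 1) * (b + 3) ≤ 2 * b ^ 2 := by
      obtain ⟨c, rfl⟩ : ∃ c, b = c + 1 := ⟨b - 1, by omega⟩
      rw [Nat.add_sub_cancel]
      nlinarith [sq_nonneg ((c : ℤ) - 1)]
    rw [f] at h₁ h₃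
    omega
  have hd12 : v₁ / b ^ 2 < v₂ / b ^ 2 := by
    refine lt_of_le_of_ne (Nat.div_le_div_right h12.le) fun h => h12.ne ?_
    exact eq_of_f_eq_of_div_eq hb he (h₁.trans h₂.symm) h
  have hd23 : v₂ / b ^ 2 < v₃ / b ^ 2 := by
    refine lt_of_le_of_ne (Nat.div_le_div_right h23.le) fun h => h23.ne ?_
    exact eq_of_f_eq_of_div_eq hb he (h₂.trans h₃.symm) h
  have hd13 : v₃ / b ^ 2 ≤ v₁ / b ^ 2 + 2 := by
    have := Nat.div_le_div_right (c := b ^ 2) hdiff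
    rwa [Nat.add_mul_div_right _ _ (by positivity)] at this
  obtain ⟨x₁, y₁, hx₁, hy₁, -, hf₁⟩ := exists_two_digits b v₁ hb
  obtain ⟨x₂, y₂, hx₂, hy₂, -, hf₂⟩ := exists_two_digits b v₂ hb
  obtain ⟨x₃, y₃, hx₃, hy₃, -, hf₃⟩ := exists_two_digits b v₃ hb
  have e2 : v₂ / b ^ 2 = v₁ / b ^ 2 + 1 := by omega
  have e3 : v₃ / b ^ 2 = v₁ / b ^ 2 + 1 + 1 := by omega
  have hsmall : ∀ v k, 0 < v / b ^ 2 → f b v = u → b ^ k ∣ v / b ^ 2 → k ≤ b := by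
    intro v k hv h hk
    by_contra hkb
    have h1 : b ^ (b + 1) ≤ v / b ^ 2 :=
      (Nat.pow_le_pow_right (by omega) (by omega)).trans (Nat.le_of_dvd hv hk)
    have h2 : b ^ (b + 1) * b ^ 2 ≤ v :=
      (Nat.mul_le_mul_right _ h1).trans (Nat.div_mul_le_self v (b ^ 2))
    rw [← pow_add] at h2
    have h3 := hlt v (lt_of_lt_of_le (by positivity) h2) h
    exact absurd h3 (not_lt.mpr h2)
  obtain ⟨k₁, hk₁, hdv₁⟩ := exists_carry b hb (v₁ / b ^ 2)
  obtain ⟨k₂, hk₂, hdv₂⟩ := exists_carry b hb (v₁ / b ^ 2 + 1)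
  have hb₁ : k₁ ≤ b := hsmall v₂ k₁ (by rw [e2]; exact Nat.succ_pos _) h₂ (by rwa [e2])
  have hb₂ : k₂ ≤ b := hsmall v₃ k₂ (by rw [e3]; exact Nat.succ_pos _) h₃ (by rwa [e3])
  have hk0 : k₁ = 0 ∨ k₂ = 0 := by
    by_contra! hne
    have d1 := (dvd_pow_self b hne.1).trans hdv₁
    have d2 := (dvd_pow_self b hne.2).trans hdv₂
    have := Nat.le_of_dvd one_pos ((Nat.dvd_add_right d1).mp d2)
    omega
  rw [h₁] at hf₁
  rw [h₃, e3] at hf₃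
  have hk : (k₁ + k₂) ≤ b := by omega
  refine false_of_carry_eq (x₃ := x₃) (y₃ := y₃) hb he hx₁ hy₁ hk ?_
  rw [mul_add]
  have e : b ^ 2 * (v₁ / b ^ 2 + 1 + 1) = b ^ 2 * (v₁ / b ^ 2) + 2 * b ^ 2 := by ring
  rw [e] at hf₃
  omega

lemma false_of_three_odd {b u v₁ v₂ v₃ : ℕ} (hb : 2 ≤ b) (hu : u ≤ b ^ 2)
    (h₁ : f b v₁ = u) (h₂ : f b v₂ = u) (h₃ : f b v₃ = u) (h12 : v₁ < v₂) (h23 : v₂ < v₃) :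
    False := by
  have hdiv : ∀ v, v ≤ v₃ → v / b ^ 2 = 0 := by
    intro v hv
    apply Nat.div_eq_of_lt
    have := s_pos b hb v₃ (by omega)
    rw [f] at h₃
    omega
  obtain ⟨x₁, y₁, hx₁, hy₁, e₁, hf₁⟩ := exists_two_digits b v₁ hb
  obtain ⟨x₂, y₂, hx₂, hy₂, e₂, hf₂⟩ := exists_two_digits b v₂ hb
  obtain ⟨x₃, y₃, hx₃, hy₃, e₃, hf₃⟩ := exists_two_digits b v₃ hb
  rw [hdiv v₁ (by omega), mul_zero, zero_add] at e₁ hf₁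
  rw [hdiv v₂ (by omega), mul_zero, zero_add] at e₂ hf₂
  rw [hdiv v₃ (by omega), mul_zero, zero_add] at e₃ hf₃
  rw [s_zero, zero_add, h₁] at hf₁
  rw [s_zero, zero_add, h₂] at hf₂
  rw [s_zero, zero_add, h₃] at hf₃
  have step : ∀ x y x' y' : ℕ, y < b → y' < b → b * x + y < b * x' + y' →
      u = (b + 1) * x + 2 * y → u = (b + 1) * x' + 2 * y' → x < x' := by
    intro x y x' y' hy hy' hlt h h'
    rcases lt_trichotomy x x' with hl | rfl | hg
    · exact hl
    · omega
    · have : b * (x' + 1) ≤ b * x := Nat.mul_le_mul_left _ hg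
      rw [mul_add] at this
      omega
  have l12 := step x₁ y₁ x₂ y₂ hy₁ hy₂ (by omega) hf₁ hf₂
  have l23 := step x₂ y₂ x₃ y₃ hy₂ hy₃ (by omega) hf₂ hf₃
  have : (b + 1) * (x₁ + 2) ≤ (b + 1) * x₃ := Nat.mul_le_mul_left _ (by omega)
  nlinarith

lemma F_ne_three {b u : ℕ}
    (h : ∀ v₁ v₂ v₃, f b v₁ = u → f b v₂ = u → f b v₃ = u → v₁ < v₂ → v₂ < v₃ → False) :
    F b u ≠ 3 := by
  intro h3
  obtain ⟨x, y, z, hxy, hxz, hyz, hs⟩ := Set.ncard_eq_three.mp h3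
  have hx : f b x = u := by
    have : x ∈ {v | f b v = u} := by rw [hs]; simp
    exact this
  have hy : f b y = u := by
    have : y ∈ {v | f b v = u} := by rw [hs]; simp
    exact this
  have hz : f b z = u := by
    have : z ∈ {v | f b v = u} := by rw [hs]; simp
    exact this
  rcases hxy.lt_or_gt with a | a <;> rcases hxz.lt_or_gt with c | c <;>
    rcases hyz.lt_or_gt with d | d
  · exact h x y z hx hy hz a d
  · exact h x z y hx hz hy c d
  · omega
  · exact h z x y hz hx hy c a
  · exact h y x z hy hx hz a c
  · omega
  · exact h y z x hy hz hx d c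
  · exact h z y x hz hy hx d a

lemma F_eq_three {b u v₁ v₂ v₃ : ℕ} (h₁ : f b v₁ = u) (h₂ : f b v₂ = u) (h₃ : f b v₃ = u)
    (h12 : v₁ < v₂) (h23 : v₂ < v₃)
    (h : ∀ v, f b v = u → v = v₁ ∨ v = v₂ ∨ v = v₃) : F b u = 3 := by
  refine Set.ncard_eq_three.mpr ⟨v₁, v₂, v₃, by omega, by omega, by omega, ?_⟩
  ext v
  simp only [Set.mem_ofPred_eq, Set.mem_insert_iff, Set.mem_singleton_iff]
  refine ⟨h v, ?_⟩
  rintro (rfl | rfl | rfl) <;> assumption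

lemma F_pow_add_one_of_even {b : ℕ} (hb : 4 ≤ b) (he : Even b) : F b (b ^ (b + 3) + 1) = 3 := by
  have hb2 : 2 ≤ b := by omega
  obtain ⟨q, hq⟩ : ∃ q, b ^ (b + 1) = q + 2 := by
    have h1 : b ^ 1 ≤ b ^ (b + 1) := Nat.pow_le_pow_right (by omega) (by omega)
    rw [pow_one] at h1
    exact ⟨b ^ (b + 1) - 2, by omega⟩
  have hN : b ^ (b + 3) = b ^ 2 * q + 2 * b ^ 2 := by
    rw [show b + 3 = 2 + (b + 1) by ring, pow_add, hq]
    ring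
  obtain ⟨c, hc⟩ : ∃ c, b = c + 1 := ⟨b - 1, by omega⟩
  have hbc : (b + 1) * (b - 1) + 1 = b ^ 2 := by
    rw [hc, Nat.add_sub_cancel]
    ring
  have hs2 : s b q + 1 = (b + 1) * (b - 1) := by
    have := s_pow_sub_two b (b + 1) hb2 (by omega)
    rwa [hq, Nat.add_sub_cancel] at this
  have hs1 : s b (q + 1) = (b + 1) * (b - 1) := by
    have := s_pow_sub_one b (b + 1) hb2
    rwa [hq] at this
  have hs0 : s b (q + 2) = 1 := by rw [← hq, s_pow b _ hb2]
  have f1 := f_two_digits b q (b - 1) 2 hb2 (by omega) (by omega)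
  have f2 := f_two_digits b (q + 1) 0 1 hb2 (by omega) (by omega)
  have f3 := f_two_digits b (q + 2) 0 0 hb2 (by omega) (by omega)
  simp only [mul_add, mul_zero, mul_one, add_zero, zero_add] at f1 f2 f3
  have d1 : b * (b - 1) + b = b ^ 2 := by
    rw [hc, Nat.add_sub_cancel]
    ring
  have hb4 : b ^ 2 = b * b := pow_two b
  have g1 : f b (b ^ 2 * q + b * (b - 1) + 2) = b ^ (b + 3) + 1 := by
    rw [f1]
    omega
  have g2 : f b (b ^ 2 * q + b ^ 2 + 1) = b ^ (b + 3) + 1 := by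
    rw [f2]
    omega
  have g3 : f b (b ^ 2 * q + b ^ 2 * 2) = b ^ (b + 3) + 1 := by
    rw [f3]
    omega
  have hb1 : 4 * b ≤ b ^ 2 := by nlinarith
  refine F_eq_three g1 g2 g3 (by omega) (by omega) ?_
  intro v hv
  have hpos : 0 < b ^ 2 := by positivity
  have hvle : v ≤ b ^ (b + 3) + 1 := by
    rw [f] at hv
    omega
  have hup : v / b ^ 2 < q + 3 := by
    rw [Nat.div_lt_iff_lt_mul hpos, add_mul, mul_comm q]
    omega
  have hlow : q ≤ v / b ^ 2 := by
    rw [Nat.le_div_iff_mul_le hpos, mul_comm q]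
    by_contra hlt
    have h1 := s_le_of_lt_pow b hb2 (b + 3) v (by omega)
    have h2 : (b - 1) * (b + 3) + 3 = b ^ 2 + 2 * b := by
      rw [hc, Nat.add_sub_cancel]
      ring
    rw [f] at hv
    omega
  have c1 : (b ^ 2 * q + b * (b - 1) + 2) / b ^ 2 = q := by
    rw [add_assoc, Nat.mul_add_div hpos, Nat.div_eq_of_lt (by omega), add_zero]
  have c2 : (b ^ 2 * q + b ^ 2 + 1) / b ^ 2 = q + 1 := by
    rw [← mul_add_one, Nat.mul_add_div hpos, Nat.div_eq_of_lt (by omega), add_zero]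
  have c3 : (b ^ 2 * q + b ^ 2 * 2) / b ^ 2 = q + 2 := by
    rw [← mul_add, Nat.mul_div_cancel_left _ hpos]
  have hcases : v / b ^ 2 = q ∨ v / b ^ 2 = q + 1 ∨ v / b ^ 2 = q + 2 := by omega
  rcases hcases with h | h | h
  · exact Or.inl (eq_of_f_eq_of_div_eq hb2 he (hv.trans g1.symm) (h.trans c1.symm))
  · exact Or.inr (Or.inl (eq_of_f_eq_of_div_eq hb2 he (hv.trans g2.symm) (h.trans c2.symm)))
  · exact Or.inr (Or.inr (eq_of_f_eq_of_div_eq hb2 he (hv.trans g3.symm) (h.trans c3.symm)))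

lemma F_sq_add_one_of_odd {b : ℕ} (hb : 5 ≤ b) (ho : Odd b) : F b (b ^ 2 + 1) = 3 := by
  have hb2 : 2 ≤ b := by omega
  obtain ⟨c, rfl⟩ := ho
  have f1 := f_two_digits (2 * c + 1) 0 (2 * c - 1) (c + 2) hb2 (by omega) (by omega)
  have f2 := f_two_digits (2 * c + 1) 0 (2 * c) 1 hb2 (by omega) (by omega)
  have f3 := f_two_digits (2 * c + 1) 1 0 0 hb2 (by omega) (by omega)
  have hs1 := s_of_lt (2 * c + 1) 1 hb2 (by omega)
  simp only [mul_add, mul_zero, mul_one, add_zero, zero_add, s_zero, hs1] at f1 f2 f3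
  obtain ⟨d, rfl⟩ : ∃ d, c = d + 1 := ⟨c - 1, by omega⟩
  have hd : 2 * (d + 1) - 1 = 2 * d + 1 := by omega
  rw [hd] at f1
  refine F_eq_three (f1.trans (by ring)) (f2.trans (by ring)) f3 (by nlinarith) (by nlinarith) ?_
  intro v hv
  obtain ⟨x, y, hx, hy, e, hf⟩ := exists_two_digits _ v hb2
  generalize v / (2 * (d + 1) + 1) ^ 2 = p at e hf
  rw [hv] at hf
  rcases Nat.eq_zero_or_pos p with rfl | hp
  · rw [s_zero] at hf
    have hx' : 2 * d + 1 ≤ x := by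
      by_contra hlt
      have : (2 * (d + 1) + 1 + 1) * x ≤ (2 * (d + 1) + 1 + 1) * (2 * d) :=
        Nat.mul_le_mul_left _ (by omega)
      nlinarith
    have hx2 : x = 2 * d + 1 ∨ x = 2 * d + 2 := by omega
    rcases hx2 with rfl | rfl
    · left
      have : y = d + 1 + 2 := by nlinarith
      rw [e, this]
      ring
    · right; left
      have : y = 1 := by nlinarith
      rw [e, this]
      ring
  · right; right
    have hsp := s_pos (2 * (d + 1) + 1) hb2 p hp
    have hp1 : p = 1 := by
      by_contra hne
      have : (2 * (d + 1) + 1) ^ 2 * 2 ≤ (2 * (d + 1) + 1) ^ 2 * p :=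
        Nat.mul_le_mul_left _ (by omega)
      nlinarith
    subst hp1
    have hx0 : x = 0 := by
      rcases Nat.eq_zero_or_pos x with h | h
      · exact h
      · have : (2 * (d + 1) + 1 + 1) * 1 ≤ (2 * (d + 1) + 1 + 1) * x := Nat.mul_le_mul_left _ h
        omega
    subst hx0
    have hy0 : y = 0 := by omega
    subst hy0
    rw [e]
    ring

lemma F_eq_card (b u : ℕ) : F b u = ((Finset.range (u + 1)).filter (fun v => f b v = u)).card := by
  rw [F, ← Set.ncard_coe_finset]
  congr 1
  ext v
  simp only [Set.mem_ofPred_eq, Finset.coe_filter, Finset.mem_range]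
  refine ⟨fun h => ⟨?_, h⟩, fun h => h.2⟩
  rw [f] at h
  omega

lemma isLeast_two : IsLeast {u : ℕ | F 2 u = 3} 129 := by
  have h : ∀ u < 129, ((Finset.range (u + 1)).filter (fun v => f 2 v = u)).card ≠ 3 := by
    decide +kernel
  refine ⟨?_, fun u hu => ?_⟩
  · rw [Set.mem_ofPred_eq, F_eq_card]
    decide +kernel
  · by_contra hlt
    rw [Set.mem_ofPred_eq, F_eq_card] at hu
    exact h u (by omega) hu

lemma isLeast_three : IsLeast {u : ℕ | F 3 u = 3} 28 := by
  have h : ∀ u < 28, ((Finset.range (u + 1)).filter (fun v => f 3 v = u)).card ≠ 3 := by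
    decide +kernel
  refine ⟨?_, fun u hu => ?_⟩
  · rw [Set.mem_ofPred_eq, F_eq_card]
    decide +kernel
  · by_contra hlt
    rw [Set.mem_ofPred_eq, F_eq_card] at hu
    exact h u (by omega) hu

lemma B_eq_of_isLeast {b n m : ℕ} (hb : 2 ≤ b) (hm : 1 ≤ m)
    (h : IsLeast {u : ℕ | F b u = n} (b ^ m + 1)) : B b n = m := by
  rw [B, K, h.csInf_eq]
  refine Nat.log_eq_of_pow_le_of_lt_pow (by omega) ?_
  have h1 : b ^ 1 ≤ b ^ m := Nat.pow_le_pow_right (by omega) hm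
  rw [pow_succ]
  nlinarith

theorem stmt10 (b : ℕ) (hb : 2 ≤ b) :
    (b = 2 → IsLeast {u : ℕ | F b u = 3} 129 ∧ B b 3 = 7) ∧
    (b = 3 → IsLeast {u : ℕ | F b u = 3} 28 ∧ B b 3 = 3) ∧
    (4 ≤ b → Even b → IsLeast {u : ℕ | F b u = 3} (b ^ (b + 3) + 1) ∧ B b 3 = b + 3) ∧
    (5 ≤ b → Odd b → IsLeast {u : ℕ | F b u = 3} (b ^ 2 + 1) ∧ B b 3 = 2) := by
  refine ⟨?_, ?_, ?_, ?_⟩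
  · rintro rfl
    exact ⟨isLeast_two, B_eq_of_isLeast (m := 7) hb (by norm_num) isLeast_two⟩
  · rintro rfl
    exact ⟨isLeast_three, B_eq_of_isLeast (m := 3) hb (by norm_num) isLeast_three⟩
  · intro h4 he
    have h : IsLeast {u : ℕ | F b u = 3} (b ^ (b + 3) + 1) := by
      refine ⟨F_pow_add_one_of_even h4 he, fun u hu => ?_⟩
      by_contra hlt
      exact F_ne_three (fun _ _ _ => false_of_three_even hb he (by omega)) hu
    exact ⟨h, B_eq_of_isLeast hb (by omega) h⟩
  · intro h5 ho
    have h : IsLeast {u : ℕ | F b u = 3} (b ^ 2 + 1) := by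
      refine ⟨F_sq_add_one_of_odd h5 ho, fun u hu => ?_⟩
      by_contra hlt
      exact F_ne_three (fun _ _ _ => false_of_three_odd hb (by omega)) hu
    exact ⟨h, B_eq_of_isLeast hb (by omega) h⟩

end Kaprekar
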